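/- Let u : ℝ² → ℝ be infinitely differentiable and let S : ℝ² → Matrix(Fin 2, Fin 2, ℝ) be the symmetric matrix function S = [[cos u, sin u],[sin u, -cos u]]. Define the operator L(g) = ∂_y g + S·(∂_x g) acting on functions g : ℝ² → ℝ². Then L satisfies the BKP constraint L†∂ + ∂L = 0 in the weak sense: for all infinitely differentiable compactly supported f, g : ℝ² → ℝ², ∫_{ℝ²} ⟨f, ∂_x(L(g))⟩ = ∫_{ℝ²} ⟨g, ∂_x(L(f))⟩, where ⟨·,·⟩ is the Euclidean inner product on ℝ². -/

import Mathlib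

open MeasureTheory

/-- Partial `x`-derivative of an `ℝ²`-valued function on `ℝ × ℝ`
(coordinates `(x, y)`). -/
noncomputable def vpdX (f : ℝ × ℝ → (Fin 2 → ℝ)) : ℝ × ℝ → (Fin 2 → ℝ) :=
  fun p => deriv (fun s => f (s, p.2)) p.1

/-- Partial `y`-derivative of an `ℝ²`-valued function on `ℝ × ℝ`. -/
noncomputable def vpdY (f : ℝ × ℝ → (Fin 2 → ℝ)) : ℝ × ℝ → (Fin 2 → ℝ) :=
  fun p => deriv (fun s => f (p.1, s)) p.2

open scoped ContDiff

section DirectionalDerivative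

variable {E : Type*} [NormedAddCommGroup E] [NormedSpace ℝ E]

lemma ContDiff.fderiv_apply_const {φ : E → ℝ} (hφ : ContDiff ℝ ∞ φ) (v : E) :
    ContDiff ℝ ∞ (fun p => fderiv ℝ φ p v) :=
  (hφ.fderiv_right (m := ∞) (by simp)).clm_apply contDiff_const

lemma ContDiff.fderiv_fderiv_apply_comm {φ : E → ℝ} (hφ : ContDiff ℝ ∞ φ) (v w p : E) :
    fderiv ℝ (fun q => fderiv ℝ φ q v) p w = fderiv ℝ (fun q => fderiv ℝ φ q w) p v := by
  have hd : DifferentiableAt ℝ (fderiv ℝ φ) p :=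
    (hφ.fderiv_right (m := ∞) (by simp)).differentiable (by simp) p
  have hs : IsSymmSndFDerivAt ℝ φ p := hφ.contDiffAt.isSymmSndFDerivAt (by
    rw [minSmoothness_of_isRCLikeNormedField]
    exact WithTop.coe_le_coe.2 (le_top : (2 : ℕ∞) ≤ ⊤))
  rw [fderiv_clm_apply hd (differentiableAt_const v), fderiv_clm_apply hd (differentiableAt_const w)]
  simpa using hs w v

variable [MeasurableSpace E] [BorelSpace E] [FiniteDimensional ℝ E]
  {μ : Measure E} [μ.IsAddHaarMeasure]

lemma integral_mul_fderiv_of_hasCompactSupport {φ ψ : E → ℝ} (hφ : ContDiff ℝ ∞ φ)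
    (hψ : ContDiff ℝ ∞ ψ) (hc : HasCompactSupport φ) (v : E) :
    ∫ p, φ p * fderiv ℝ ψ p v ∂μ = -∫ p, fderiv ℝ φ p v * ψ p ∂μ :=
  integral_mul_fderiv_eq_neg_fderiv_mul_of_integrable
    (((hφ.fderiv_apply_const v).continuous.mul hψ.continuous).integrable_of_hasCompactSupport
      (hc.fderiv_apply ℝ v).mul_right)
    ((hφ.continuous.mul (hψ.fderiv_apply_const v).continuous).integrable_of_hasCompactSupport
      hc.mul_right)
    ((hφ.continuous.mul hψ.continuous).integrable_of_hasCompactSupport hc.mul_right)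
    (fun x _ => hφ.differentiable (by simp) x) (fun x _ => hψ.differentiable (by simp) x)

lemma integral_fderiv_mul_fderiv_comm {φ ψ : E → ℝ} (hφ : ContDiff ℝ ∞ φ)
    (hψ : ContDiff ℝ ∞ ψ) (hc : HasCompactSupport φ) (v w : E) :
    ∫ p, fderiv ℝ φ p v * fderiv ℝ ψ p w ∂μ = ∫ p, fderiv ℝ φ p w * fderiv ℝ ψ p v ∂μ := by
  have h₁ := integral_mul_fderiv_of_hasCompactSupport (μ := μ) hφ (hψ.fderiv_apply_const w) hc v
  have h₂ := integral_mul_fderiv_of_hasCompactSupport (μ := μ) hφ (hψ.fderiv_apply_const v) hc w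
  simp only [hψ.fderiv_fderiv_apply_comm w v] at h₁
  linarith

end DirectionalDerivative

lemma vpdX_apply {h : ℝ × ℝ → Fin 2 → ℝ} (hh : ContDiff ℝ ∞ h) (p : ℝ × ℝ) (i : Fin 2) :
    vpdX h p i = fderiv ℝ (fun q => h q i) p (1, 0) := by
  have hd : HasFDerivAt h (fderiv ℝ h p) (p.1, p.2) :=
    (hh.differentiable (by simp) p).hasFDerivAt
  have hc : HasDerivAt (fun s : ℝ => (s, p.2)) ((1 : ℝ), (0 : ℝ)) p.1 :=
    (hasDerivAt_id _).prodMk (hasDerivAt_const _ _)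
  have h₁ : vpdX h p = fderiv ℝ h p (1, 0) := (hd.comp_hasDerivAt p.1 hc).deriv
  rw [h₁, (hasFDerivAt_pi'.1 hd i).fderiv]
  rfl

lemma vpdY_apply {h : ℝ × ℝ → Fin 2 → ℝ} (hh : ContDiff ℝ ∞ h) (p : ℝ × ℝ) (i : Fin 2) :
    vpdY h p i = fderiv ℝ (fun q => h q i) p (0, 1) := by
  have hd : HasFDerivAt h (fderiv ℝ h p) (p.1, p.2) :=
    (hh.differentiable (by simp) p).hasFDerivAt
  have hc : HasDerivAt (fun s : ℝ => (p.1, s)) ((0 : ℝ), (1 : ℝ)) p.2 :=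
    (hasDerivAt_const _ _).prodMk (hasDerivAt_id _)
  have h₁ : vpdY h p = fderiv ℝ h p (0, 1) := (hd.comp_hasDerivAt p.2 hc).deriv
  rw [h₁, (hasFDerivAt_pi'.1 hd i).fderiv]
  rfl

lemma ContDiff.vpdX {h : ℝ × ℝ → Fin 2 → ℝ} (hh : ContDiff ℝ ∞ h) : ContDiff ℝ ∞ (vpdX h) :=
  contDiff_pi.2 fun i => by
    simpa only [vpdX_apply hh] using (contDiff_pi.1 hh i).fderiv_apply_const (1, 0)

lemma ContDiff.vpdY {h : ℝ × ℝ → Fin 2 → ℝ} (hh : ContDiff ℝ ∞ h) : ContDiff ℝ ∞ (vpdY h) :=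
  contDiff_pi.2 fun i => by
    simpa only [vpdY_apply hh] using (contDiff_pi.1 hh i).fderiv_apply_const (0, 1)

lemma HasCompactSupport.apply_fin {h : ℝ × ℝ → Fin 2 → ℝ} (hc : HasCompactSupport h) (i : Fin 2) :
    HasCompactSupport (fun p => h p i) :=
  hc.comp_left (g := fun x : Fin 2 → ℝ => x i) rfl

lemma HasCompactSupport.vpdX_apply {h : ℝ × ℝ → Fin 2 → ℝ} (hh : ContDiff ℝ ∞ h)
    (hc : HasCompactSupport h) (i : Fin 2) : HasCompactSupport (fun p => vpdX h p i) := by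
  simpa only [_root_.vpdX_apply hh] using (hc.apply_fin i).fderiv_apply ℝ (1, 0)

lemma HasCompactSupport.vpdY_apply {h : ℝ × ℝ → Fin 2 → ℝ} (hh : ContDiff ℝ ∞ h)
    (hc : HasCompactSupport h) (i : Fin 2) : HasCompactSupport (fun p => vpdY h p i) := by
  simpa only [_root_.vpdY_apply hh] using (hc.apply_fin i).fderiv_apply ℝ (0, 1)

/-- Integration by parts for the Euclidean pairing in the `x`-direction. -/
lemma integral_sum_mul_vpdX {f h : ℝ × ℝ → Fin 2 → ℝ} (hf : ContDiff ℝ ∞ f)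
    (hh : ContDiff ℝ ∞ h) (hfc : HasCompactSupport f) :
    ∫ p, ∑ i, f p i * vpdX h p i = -∫ p, ∑ i, vpdX f p i * h p i := by
  rw [integral_finsetSum, integral_finsetSum, ← Finset.sum_neg_distrib]
  · refine Finset.sum_congr rfl fun i _ => ?_
    simp only [vpdX_apply hf, vpdX_apply hh]
    exact integral_mul_fderiv_of_hasCompactSupport (contDiff_pi.1 hf i) (contDiff_pi.1 hh i)
      (hfc.apply_fin i) _
  · exact fun i _ => ((contDiff_pi.1 hf.vpdX i).continuous.mul
      (contDiff_pi.1 hh i).continuous).integrable_of_hasCompactSupport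
      (hfc.vpdX_apply hf i).mul_right
  · exact fun i _ => ((contDiff_pi.1 hf i).continuous.mul
      (contDiff_pi.1 hh.vpdX i).continuous).integrable_of_hasCompactSupport
      (hfc.apply_fin i).mul_right

lemma integrable_sum_mul {f h : ℝ × ℝ → Fin 2 → ℝ} (hf : ContDiff ℝ ∞ f)
    (hh : ContDiff ℝ ∞ h) (hfc : ∀ i, HasCompactSupport (fun p => f p i)) :
    Integrable (fun p => ∑ i, f p i * h p i) :=
  integrable_finsetSum _ fun i _ => ((contDiff_pi.1 hf i).continuous.mul
    (contDiff_pi.1 hh i).continuous).integrable_of_hasCompactSupport (hfc i).mul_right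

lemma integral_sum_vpdX_mul_vpdY {f g : ℝ × ℝ → Fin 2 → ℝ} (hf : ContDiff ℝ ∞ f)
    (hg : ContDiff ℝ ∞ g) (hfc : HasCompactSupport f) :
    ∫ p, ∑ i, vpdX f p i * vpdY g p i = ∫ p, ∑ i, vpdY f p i * vpdX g p i := by
  rw [integral_finsetSum, integral_finsetSum]
  · refine Finset.sum_congr rfl fun i _ => ?_
    simp only [vpdX_apply hf, vpdX_apply hg, vpdY_apply hf, vpdY_apply hg]
    exact integral_fderiv_mul_fderiv_comm (contDiff_pi.1 hf i) (contDiff_pi.1 hg i)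
      (hfc.apply_fin i) _ _
  · exact fun i _ => ((contDiff_pi.1 hf.vpdY i).continuous.mul
      (contDiff_pi.1 hg.vpdX i).continuous).integrable_of_hasCompactSupport
      (hfc.vpdY_apply hf i).mul_right
  · exact fun i _ => ((contDiff_pi.1 hf.vpdX i).continuous.mul
      (contDiff_pi.1 hg.vpdY i).continuous).integrable_of_hasCompactSupport
      (hfc.vpdX_apply hf i).mul_right

/-- The modified Novikov–Veselov Lax operator `L = ∂_y + S ∂_x` with
`S = [[cos u, sin u], [sin u, -cos u]]` satisfies the BKP constraint
`L†∂ + ∂L = 0`: the bilinear form `(f, g) ↦ ∫ ⟨f, ∂_x(L g)⟩` on compactly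
supported smooth `ℝ²`-valued functions is symmetric. -/
theorem mNV_BKP_constraint (u : ℝ × ℝ → ℝ) (hu : ContDiff ℝ (⊤ : ℕ∞) u)
    (f g : ℝ × ℝ → (Fin 2 → ℝ)) (hf : ContDiff ℝ (⊤ : ℕ∞) f) (hg : ContDiff ℝ (⊤ : ℕ∞) g)
    (hfc : HasCompactSupport f) (hgc : HasCompactSupport g) :
    ∫ p : ℝ × ℝ, ∑ i : Fin 2,
        f p i *
          vpdX (fun q => vpdY g q +
            (!![Real.cos (u q), Real.sin (u q);
                Real.sin (u q), -Real.cos (u q)]).mulVec (vpdX g q)) p i =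
      ∫ p : ℝ × ℝ, ∑ i : Fin 2,
        g p i *
          vpdX (fun q => vpdY f q +
            (!![Real.cos (u q), Real.sin (u q);
                Real.sin (u q), -Real.cos (u q)]).mulVec (vpdX f q)) p i := by
  have hS : ∀ {h : ℝ × ℝ → Fin 2 → ℝ}, ContDiff ℝ ∞ h → ContDiff ℝ ∞ (fun q =>
      (!![Real.cos (u q), Real.sin (u q); Real.sin (u q), -Real.cos (u q)]).mulVec (vpdX h q)) := by
    intro h hh
    have h₀ := contDiff_pi.1 hh.vpdX 0
    have h₁ := contDiff_pi.1 hh.vpdX 1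
    refine contDiff_pi.2 fun i => ?_
    fin_cases i
    · simpa [Matrix.mulVec, dotProduct, Fin.sum_univ_two] using
        (hu.cos.mul h₀).add (hu.sin.mul h₁)
    · simpa [Matrix.mulVec, dotProduct, Fin.sum_univ_two] using
        (hu.sin.mul h₀).add (hu.cos.mul h₁).neg
  rw [integral_sum_mul_vpdX hf (hg.vpdY.add (hS hg)) hfc,
    integral_sum_mul_vpdX hg (hf.vpdY.add (hS hf)) hgc]
  simp only [Pi.add_apply, mul_add, Finset.sum_add_distrib]
  rw [integral_add (integrable_sum_mul hf.vpdX hg.vpdY (hfc.vpdX_apply hf))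
      (integrable_sum_mul hf.vpdX (hS hg) (hfc.vpdX_apply hf)),
    integral_add (integrable_sum_mul hg.vpdX hf.vpdY (hgc.vpdX_apply hg))
      (integrable_sum_mul hg.vpdX (hS hf) (hgc.vpdX_apply hg)),
    integral_sum_vpdX_mul_vpdY hf hg hfc]
  congr 3
  · simp only [mul_comm]
  · funext p
    simp only [Matrix.mulVec, dotProduct, Fin.sum_univ_two, Matrix.of_apply, Matrix.cons_val_zero,
      Matrix.cons_val_one]
    ring
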